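/- arXiv:math/0503006 — 3 statements merged into one kernel-verified Lean document; each statement's English description precedes it below -/
import Mathlib

section
/- Let I be a transport along paths in (E,π,B) satisfying conditions (1.5) and (1.6), and for each path γ : [a,b] → B define φ_γ := I^γ_{a→b}. Then for all paths γ₁, γ₂ : [0,1] → B with γ₁(1) = γ₂(0), one has φ_{γ₁γ₂} = φ_{γ₂} ∘ φ_{γ₁} (property (2.13)), where γ₁γ₂ is the canonical product path. -/
open Set Function

variable {E B : Type*}

/-- The fibre of `π : E → B` over `x : B`. -/
def Fibre (π : E → B) (x : B) : Set E := {u : E | π u = x}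

/-- The left endpoint of `[a,b]` as an element of `Set.Icc a b`. -/
def lpt {a b : ℝ} (hab : a ≤ b) : Icc a b := ⟨a, Set.left_mem_Icc.mpr hab⟩

/-- The right endpoint of `[a,b]` as an element of `Set.Icc a b`. -/
def rpt {a b : ℝ} (hab : a ≤ b) : Icc a b := ⟨b, Set.right_mem_Icc.mpr hab⟩

/-- Restriction of a path `γ : [a,b] → B` to a subinterval `[c,d] ⊆ [a,b]`. -/
def restr {a b c d : ℝ} (γ : Icc a b → B) (h : Icc c d ⊆ Icc a b) : Icc c d → B :=
  γ ∘ Set.inclusion h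

/-- A transport along paths in the fibre bundle `(E, π, B)`: to every path
`γ : [a,b] → B` and all `s, t ∈ [a,b]` it assigns a map `I a b γ s t : E → E` mapping
the fibre over `γ s` into the fibre over `γ t` (values outside this fibre are
irrelevant), satisfying (1.2) and (1.3) on the fibres. -/
structure TransportAlongPaths (π : E → B) where
  I : ∀ (a b : ℝ), (Icc a b → B) → Icc a b → Icc a b → E → E
  maps_fibre : ∀ (a b : ℝ) (γ : Icc a b → B) (s t : Icc a b) (u : E),
    π u = γ s → π (I a b γ s t u) = γ t
  comp : ∀ (a b : ℝ) (γ : Icc a b → B) (r s t : Icc a b) (u : E),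
    π u = γ s → I a b γ t r (I a b γ s t u) = I a b γ s r u
  id_eq : ∀ (a b : ℝ) (γ : Icc a b → B) (s : Icc a b) (u : E),
    π u = γ s → I a b γ s s u = u

/-- Condition (1.5): invariance under restriction to subintervals. -/
def Cond15 (π : E → B) (I : ∀ (a b : ℝ), (Icc a b → B) → Icc a b → Icc a b → E → E) : Prop :=
  ∀ (a b c d : ℝ) (γ : Icc a b → B) (h : Icc c d ⊆ Icc a b) (s t : Icc c d) (u : E),
    π u = γ (Set.inclusion h s) →
      I c d (restr γ h) s t u = I a b γ (Set.inclusion h s) (Set.inclusion h t) u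

/-- Condition (1.6), for arbitrary (one-to-one, onto) reparametrizations of intervals. -/
def Cond16 (π : E → B) (I : ∀ (a b : ℝ), (Icc a b → B) → Icc a b → Icc a b → E → E) : Prop :=
  ∀ (a b c d : ℝ) (γ : Icc a b → B) (τ : Icc c d → Icc a b), Function.Bijective τ →
    ∀ (s t : Icc c d) (u : E), π u = γ (τ s) →
      I c d (γ ∘ τ) s t u = I a b γ (τ s) (τ t) u

/-- Condition (1.6) (= (4.4)) restricted to strictly increasing bijections. -/
def Cond16Inc (π : E → B) (I : ∀ (a b : ℝ), (Icc a b → B) → Icc a b → Icc a b → E → E) : Prop :=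
  ∀ (a b c d : ℝ) (γ : Icc a b → B) (τ : Icc c d → Icc a b),
    Function.Bijective τ → StrictMono τ →
    ∀ (s t : Icc c d) (u : E), π u = γ (τ s) →
      I c d (γ ∘ τ) s t u = I a b γ (τ s) (τ t) u

/-- The parallel transport `φ_γ := I^γ_{a→b}` assigned to a path `γ : [a,b] → B`. -/
def ppt (π : E → B) (T : TransportAlongPaths π) {a b : ℝ} (hab : a ≤ b)
    (γ : Icc a b → B) : E → E :=
  T.I a b γ (lpt hab) (rpt hab)

/-- The parallel transport `φ : γ ↦ φ_γ := I^γ_{a→b}` as a family over all paths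
(with a junk value for paths on empty intervals). -/
noncomputable def pTrans (π : E → B) (T : TransportAlongPaths π) (a b : ℝ)
    (γ : Icc a b → B) : E → E :=
  if hab : a ≤ b then T.I a b γ (lpt hab) (rpt hab) else id

/-- The canonically inverse path `γ₋(s) := γ(1-s)` of a path `γ : [0,1] → B`. -/
def inv01 (γ : Icc (0:ℝ) 1 → B) : Icc (0:ℝ) 1 → B := fun s =>
  γ ⟨1 - s.1, Set.mem_Icc.mpr ⟨by have := s.2.2; linarith, by have := s.2.1; linarith⟩⟩

/-- The canonically inverse path `η₋ := η ∘ τᶜ₋`, `τᶜ₋(s) := a + b - s`, of `η : [a,b] → B`. -/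
def invIcc {a b : ℝ} (γ : Icc a b → B) : Icc a b → B := fun s =>
  γ ⟨a + b - s.1, Set.mem_Icc.mpr ⟨by have := s.2.2; linarith, by have := s.2.1; linarith⟩⟩

/-- The canonical product of paths `γ₁, γ₂ : [0,1] → B`: `(γ₁γ₂)(s) = γ₁(2s)` for
`s ∈ [0,1/2]` and `(γ₁γ₂)(s) = γ₂(2s-1)` for `s ∈ [1/2,1]`. -/
noncomputable def prod01 (γ₁ γ₂ : Icc (0:ℝ) 1 → B) : Icc (0:ℝ) 1 → B := fun s =>
  if h : s.1 ≤ 1/2 then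
    γ₁ ⟨2 * s.1, Set.mem_Icc.mpr ⟨by have := s.2.1; linarith, by linarith⟩⟩
  else
    γ₂ ⟨2 * s.1 - 1, Set.mem_Icc.mpr ⟨by push_neg at h; linarith, by have := s.2.2; linarith⟩⟩

/-- Each `φ_γ` is a bijection from the fibre over `γ(a)` onto the fibre over `γ(b)`. -/
def PhiBij (π : E → B) (Φ : ∀ (a b : ℝ), (Icc a b → B) → E → E) : Prop :=
  ∀ (a b : ℝ) (hab : a ≤ b) (γ : Icc a b → B),
    Set.BijOn (Φ a b γ) (Fibre π (γ (lpt hab))) (Fibre π (γ (rpt hab)))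

/-- Property (2.11): invariance under orientation preserving reparametrizations. -/
def Cond211 (π : E → B) (Φ : ∀ (a b : ℝ), (Icc a b → B) → E → E) : Prop :=
  ∀ (a b c d : ℝ) (hab : a ≤ b) (hcd : c ≤ d) (γ : Icc a b → B)
    (τ : Icc c d → Icc a b), Function.Bijective τ → StrictMono τ →
    ∀ u : E, π u = γ (lpt hab) → Φ c d (γ ∘ τ) u = Φ a b γ u

/-- Property (2.12): `φ_{γ₋} = (φ_γ)⁻¹` as maps between the fibres over `γ(0)` and `γ(1)`. -/
def Cond212 (π : E → B) (Φ : ∀ (a b : ℝ), (Icc a b → B) → E → E) : Prop :=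
  ∀ γ : Icc (0:ℝ) 1 → B,
    (∀ u : E, π u = γ (lpt zero_le_one) → Φ 0 1 (inv01 γ) (Φ 0 1 γ u) = u) ∧
    (∀ u : E, π u = γ (rpt zero_le_one) → Φ 0 1 γ (Φ 0 1 (inv01 γ) u) = u)

/-- Property (2.13): `φ_{γ₁γ₂} = φ_{γ₂} ∘ φ_{γ₁}` on the fibre over `γ₁(0)`. -/
def Cond213 (π : E → B) (Φ : ∀ (a b : ℝ), (Icc a b → B) → E → E) : Prop :=
  ∀ γ₁ γ₂ : Icc (0:ℝ) 1 → B, γ₁ (rpt zero_le_one) = γ₂ (lpt zero_le_one) →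
    ∀ u : E, π u = γ₁ (lpt zero_le_one) →
      Φ 0 1 (prod01 γ₁ γ₂) u = Φ 0 1 γ₂ (Φ 0 1 γ₁ u)

/-- Property (2.14): the transport assigned to a one-point path is the identity on the fibre. -/
def Cond214 (π : E → B) (Φ : ∀ (a b : ℝ), (Icc a b → B) → E → E) : Prop :=
  ∀ (a : ℝ) (γ : Icc a a → B) (u : E), π u = γ (lpt le_rfl) → Φ a a γ u = u

/-- An axiomatically defined parallel transport in `(E, π, B)`: every `φ_γ` is a
bijection between the corresponding fibres and (2.11)-(2.14) hold. -/
structure IsParTransport (π : E → B) (Φ : ∀ (a b : ℝ), (Icc a b → B) → E → E) : Prop where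
  bij : PhiBij π Φ
  par211 : Cond211 π Φ
  par212 : Cond212 π Φ
  par213 : Cond213 π Φ
  par214 : Cond214 π Φ

/-- The transport along paths induced by a parallel transport:
`I^γ_{s→t} := φ_{γ|[a,t]} ∘ (φ_{γ|[a,s]})⁻¹`, where `(φ_{γ|[a,s]})⁻¹` is the inverse of
the bijection `φ_{γ|[a,s]}` from the fibre over `γ(a)` onto the fibre over `γ(s)`. -/
noncomputable def indTransport [Nonempty E] (π : E → B)
    (Φ : ∀ (a b : ℝ), (Icc a b → B) → E → E) (a b : ℝ) (γ : Icc a b → B)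
    (s t : Icc a b) : E → E := fun v =>
  Φ a t.1 (restr γ (Set.Icc_subset_Icc le_rfl t.2.2))
    (Function.invFunOn (Φ a s.1 (restr γ (Set.Icc_subset_Icc le_rfl s.2.2)))
      (Fibre π (γ ⟨a, Set.left_mem_Icc.mpr (le_trans s.2.1 s.2.2)⟩)) v)

/-- If the restriction of `γ` to `[c,d]` is the reparametrization `δ ∘ τ` of a path `δ`, then the
transports along `γ` and `δ` agree at corresponding parameters. -/
theorem transport_eq_of_restr_eq_comp {π : E → B} {T : TransportAlongPaths π}
    (h15 : Cond15 π T.I) (h16 : Cond16 π T.I) {a b a' b' c d : ℝ}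
    {γ : Icc a b → B} {δ : Icc a' b' → B} (h : Icc c d ⊆ Icc a b)
    {τ : Icc c d → Icc a' b'} (hτ : Function.Bijective τ) (hγ : restr γ h = δ ∘ τ)
    (s t : Icc c d) {u : E} (hu : π u = δ (τ s)) :
    T.I a b γ (Set.inclusion h s) (Set.inclusion h t) u = T.I a' b' δ (τ s) (τ t) u := by
  have hs : π u = γ (Set.inclusion h s) := hu.trans (congrFun hγ s).symm
  rw [← h15 a b c d γ h s t u hs, hγ, h16 a' b' c d δ τ hτ s t u hu]

/-- The reparametrization `s ↦ 2s` of `[0,1/2]` onto `[0,1]`. -/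
noncomputable def doubleLeft (s : Icc (0:ℝ) (1/2)) : Icc (0:ℝ) 1 :=
  ⟨2 * s.1, by have := s.2.1; linarith, by have := s.2.2; linarith⟩

/-- The reparametrization `s ↦ 2s - 1` of `[1/2,1]` onto `[0,1]`. -/
noncomputable def doubleRight (s : Icc (1/2:ℝ) 1) : Icc (0:ℝ) 1 :=
  ⟨2 * s.1 - 1, by have := s.2.1; linarith, by have := s.2.2; linarith⟩

theorem doubleLeft_bijective : Function.Bijective doubleLeft := by
  refine ⟨fun s t hst => Subtype.ext ?_, fun y =>
    ⟨⟨y.1 / 2, by have := y.2.1; linarith, by have := y.2.2; linarith⟩, Subtype.ext ?_⟩⟩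
  · have : 2 * s.1 = 2 * t.1 := congrArg Subtype.val hst
    linarith
  · change 2 * (y.1 / 2) = y.1
    ring

theorem doubleRight_bijective : Function.Bijective doubleRight := by
  refine ⟨fun s t hst => Subtype.ext ?_, fun y =>
    ⟨⟨(y.1 + 1) / 2, by have := y.2.1; linarith, by have := y.2.2; linarith⟩, Subtype.ext ?_⟩⟩
  · have : 2 * s.1 - 1 = 2 * t.1 - 1 := congrArg Subtype.val hst
    linarith
  · change 2 * ((y.1 + 1) / 2) - 1 = y.1
    ring

theorem restr_prod01_left (γ₁ γ₂ : Icc (0:ℝ) 1 → B) (h : Icc (0:ℝ) (1/2) ⊆ Icc (0:ℝ) 1) :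
    restr (prod01 γ₁ γ₂) h = γ₁ ∘ doubleLeft :=
  funext fun s => dif_pos s.2.2

theorem restr_prod01_right {γ₁ γ₂ : Icc (0:ℝ) 1 → B}
    (hconn : γ₁ (rpt zero_le_one) = γ₂ (lpt zero_le_one))
    (h : Icc (1/2:ℝ) 1 ⊆ Icc (0:ℝ) 1) :
    restr (prod01 γ₁ γ₂) h = γ₂ ∘ doubleRight := by
  funext s
  by_cases hs : s.1 ≤ 1/2
  · have hs' : s.1 = 1/2 := le_antisymm hs s.2.1
    refine (dif_pos hs).trans (Eq.trans (congrArg γ₁ (Subtype.ext ?_))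
      (hconn.trans (congrArg γ₂ (Subtype.ext ?_))))
    · change 2 * s.1 = 1
      linarith
    · change 0 = 2 * s.1 - 1
      linarith
  · exact dif_neg hs

/-- conditions (1.5) and (1.6) imply property (2.13),
`φ_{γ₁γ₂} = φ_{γ₂} ∘ φ_{γ₁}`, for `φ_γ := I^γ_{a→b}`. -/
theorem stmt3 (π : E → B) (T : TransportAlongPaths π)
    (h15 : Cond15 π T.I) (h16 : Cond16 π T.I)
    (γ₁ γ₂ : Icc (0:ℝ) 1 → B) (hconn : γ₁ (rpt zero_le_one) = γ₂ (lpt zero_le_one)) :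
    ∀ u : E, π u = γ₁ (lpt zero_le_one) →
      ppt π T zero_le_one (prod01 γ₁ γ₂) u =
        ppt π T zero_le_one γ₂ (ppt π T zero_le_one γ₁ u) := by
  intro u hu
  have hL : Icc (0:ℝ) (1/2) ⊆ Icc (0:ℝ) 1 := Icc_subset_Icc le_rfl (by norm_num)
  have hR : Icc (1/2:ℝ) 1 ⊆ Icc (0:ℝ) 1 := Icc_subset_Icc (by norm_num) le_rfl
  have h0 : (0:ℝ) ≤ 1/2 := by norm_num
  have h1 : (1/2:ℝ) ≤ 1 := by norm_num
  have eL0 : doubleLeft (lpt h0) = lpt zero_le_one := Subtype.ext (by simp [doubleLeft, lpt])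
  have eL1 : doubleLeft (rpt h0) = rpt zero_le_one := Subtype.ext (by simp [doubleLeft, rpt])
  have eR0 : doubleRight (lpt h1) = lpt zero_le_one := Subtype.ext (by simp [doubleRight, lpt])
  have eR1 : doubleRight (rpt h1) = rpt zero_le_one :=
    Subtype.ext (by norm_num [doubleRight, rpt])
  have hv : π (T.I 0 1 γ₁ (lpt zero_le_one) (rpt zero_le_one) u) = γ₂ (lpt zero_le_one) :=
    (T.maps_fibre 0 1 γ₁ _ _ u hu).trans hconn
  have left := transport_eq_of_restr_eq_comp h15 h16 hL doubleLeft_bijective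
    (restr_prod01_left γ₁ γ₂ hL) (lpt h0) (rpt h0) (hu.trans (congrArg γ₁ eL0.symm))
  have right := transport_eq_of_restr_eq_comp h15 h16 hR doubleRight_bijective
    (restr_prod01_right hconn hR) (lpt h1) (rpt h1) (hv.trans (congrArg γ₂ eR0.symm))
  have hu' : π u = prod01 γ₁ γ₂ (Set.inclusion hL (lpt h0)) :=
    hu.trans ((congrArg γ₁ eL0.symm).trans
      (congrFun (restr_prod01_left γ₁ γ₂ hL) (lpt h0)).symm)
  rw [eL0, eL1] at left
  rw [eR0, eR1, ← left] at right
  have hcomp := T.comp 0 1 (prod01 γ₁ γ₂) (Set.inclusion hR (rpt h1))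
    (Set.inclusion hL (lpt h0)) (Set.inclusion hL (rpt h0)) u hu'
  change T.I 0 1 (prod01 γ₁ γ₂) (Set.inclusion hL (lpt h0)) (Set.inclusion hR (rpt h1)) u =
    T.I 0 1 γ₂ _ _ (T.I 0 1 γ₁ _ _ u)
  rw [← left, ← right]
  exact hcomp.symm
end

section
/- (Theorem 3.1, second direction.) Let φ be an axiomatically defined parallel transport in (E,π,B). For each path γ : [a,b] → B and s,t ∈ [a,b] define I^γ_{s→t} := φ_{γ|[a,t]} ∘ (φ_{γ|[a,s]})⁻¹. Then I is a transport along paths (each I^γ_{s→t} is a bijection and (1.2), (1.3) hold), I satisfies condition (1.5), and I satisfies condition (1.6) for every strictly monotone bijection τ : [c,d] → [a,b]. -/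
open Set Function

variable {E B : Type*}

/-- The value of `Φ` on the restriction to `[a,b]` of a map `f : ℝ → B`. -/
def transportOn (Φ : ∀ (a b : ℝ), (Icc a b → B) → E → E) (f : ℝ → B) (a b : ℝ) : E → E :=
  Φ a b fun x => f x

namespace IsParTransport

variable {π : E → B} {Φ : ∀ (a b : ℝ), (Icc a b → B) → E → E}

theorem bijOn_transportOn (hΦ : IsParTransport π Φ) (f : ℝ → B) {a b : ℝ} (hab : a ≤ b) :
    BijOn (transportOn Φ f a b) (Fibre π (f a)) (Fibre π (f b)) :=
  hΦ.bij a b hab fun x => f x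

theorem transportOn_self (hΦ : IsParTransport π Φ) (f : ℝ → B) {a : ℝ} {u : E}
    (hu : π u = f a) : transportOn Φ f a a u = u :=
  hΦ.par214 a _ u hu

theorem transportOn_congr {f g : ℝ → B} {a b : ℝ} (h : ∀ x ∈ Icc a b, f x = g x) :
    transportOn Φ f a b = transportOn Φ g a b :=
  congrArg (Φ a b) (funext fun x => h x x.2)

theorem transportOn_reparam (hΦ : IsParTransport π Φ) {f g : ℝ → B} {a b c d : ℝ} (σ : ℝ → ℝ)
    (hcd : c ≤ d) (hσc : σ c = a) (hσd : σ d = b) (hmono : StrictMonoOn σ (Icc c d))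
    (hsurj : SurjOn σ (Icc c d) (Icc a b)) (hg : ∀ x ∈ Icc c d, g x = f (σ x))
    {u : E} (hu : π u = f a) :
    transportOn Φ g c d u = transportOn Φ f a b u := by
  subst hσc hσd
  have hmaps : MapsTo σ (Icc c d) (Icc (σ c) (σ d)) := fun x hx =>
    ⟨hmono.monotoneOn (left_mem_Icc.mpr hcd) hx hx.1,
      hmono.monotoneOn hx (right_mem_Icc.mpr hcd) hx.2⟩
  have hab : σ c ≤ σ d := hmono.monotoneOn (left_mem_Icc.mpr hcd) (right_mem_Icc.mpr hcd) hcd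
  have hτ : StrictMono (hmaps.restrict σ (Icc c d) (Icc (σ c) (σ d))) := fun x y hxy =>
    hmono x.2 y.2 hxy
  have hbij : Bijective (hmaps.restrict σ (Icc c d) (Icc (σ c) (σ d))) := by
    refine ⟨hτ.injective, fun y => ?_⟩
    obtain ⟨x, hx, hxy⟩ := hsurj y.2
    exact ⟨⟨x, hx⟩, Subtype.ext hxy⟩
  rw [transportOn_congr hg]
  exact hΦ.par211 _ _ c d hab hcd (fun x => f x) _ hbij hτ u hu

theorem transportOn_unitInterval (hΦ : IsParTransport π Φ) (f : ℝ → B) {a b : ℝ} (hab : a < b)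
    {u : E} (hu : π u = f a) :
    transportOn Φ (fun x => f (a + (b - a) * x)) 0 1 u = transportOn Φ f a b u := by
  have hpos : 0 < b - a := sub_pos.mpr hab
  refine hΦ.transportOn_reparam (fun x => a + (b - a) * x) zero_le_one (by ring) (by ring)
    (fun x _ y _ hxy => by
      have := mul_lt_mul_of_pos_left hxy hpos
      simp only; linarith)
    (fun y hy => ⟨(y - a) / (b - a), ⟨div_nonneg (by linarith [hy.1]) hpos.le,
      (div_le_one hpos).mpr (by linarith [hy.2])⟩, ?_⟩) (fun x _ => rfl) hu
  simp only
  field_simp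
  ring

theorem transportOn_comp (hΦ : IsParTransport π Φ) (f : ℝ → B) {a s t : ℝ} (has : a ≤ s)
    (hst : s ≤ t) {u : E} (hu : π u = f a) :
    transportOn Φ f s t (transportOn Φ f a s u) = transportOn Φ f a t u := by
  have hv : π (transportOn Φ f a s u) = f s := (hΦ.bijOn_transportOn f has).mapsTo hu
  rcases has.eq_or_lt with rfl | has
  · rw [hΦ.transportOn_self f hu]
  rcases hst.eq_or_lt with rfl | hst
  · rw [hΦ.transportOn_self f hv]
  rw [← hΦ.transportOn_unitInterval f hst hv, ← hΦ.transportOn_unitInterval f has hu]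
  have hprod := hΦ.par213 (fun x => f (a + (s - a) * x)) (fun x => f (s + (t - s) * x))
    (by simp [lpt, rpt]) u (by simpa [lpt] using hu)
  refine hprod.symm.trans ?_
  have h₁ : 0 < s - a := sub_pos.mpr has
  have h₂ : 0 < t - s := sub_pos.mpr hst
  let σ : ℝ → ℝ := fun x =>
    if x ≤ 1 / 2 then a + (s - a) * (2 * x) else s + (t - s) * (2 * x - 1)
  have hpath : prod01 (fun x => f (a + (s - a) * x)) (fun x => f (s + (t - s) * x)) =
      fun x : Icc (0 : ℝ) 1 => f (σ x) := by
    funext x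
    simp only [prod01, σ]
    split_ifs <;> rfl
  rw [hpath]
  refine hΦ.transportOn_reparam (g := fun x => f (σ x)) σ zero_le_one (by simp [σ])
    (by norm_num [σ]) ?_ ?_ (fun x _ => rfl) hu
  · intro x _ y _ hxy
    simp only [σ]
    split_ifs <;> nlinarith
  · intro y hy
    rcases le_or_gt y s with hys | hys
    · have hle : (y - a) / (s - a) ≤ 1 := (div_le_one h₁).mpr (by linarith)
      have h0 : 0 ≤ (y - a) / (s - a) := div_nonneg (by linarith [hy.1]) h₁.le
      refine ⟨(y - a) / (s - a) / 2, ⟨by linarith, by linarith⟩, ?_⟩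
      simp only [σ]
      rw [if_pos (by linarith)]
      field_simp
      ring
    · have hle : (y - s) / (t - s) ≤ 1 := (div_le_one h₂).mpr (by linarith [hy.2])
      have h0 : 0 < (y - s) / (t - s) := div_pos (by linarith) h₂
      refine ⟨((y - s) / (t - s) + 1) / 2, ⟨by linarith, by linarith⟩, ?_⟩
      simp only [σ]
      rw [if_neg (by linarith)]
      field_simp
      ring

theorem transportOn_reverse (hΦ : IsParTransport π Φ) {f g : ℝ → B} {s t s' t' : ℝ} (k : ℝ)
    (hst : s ≤ t) (hs' : s' = k - t) (ht' : t' = k - s) (hg : ∀ x ∈ Icc s' t', g x = f (k - x))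
    {u : E} (hu : π u = f s) :
    transportOn Φ g s' t' (transportOn Φ f s t u) = u := by
  subst hs' ht'
  rw [transportOn_congr hg]
  have hv : π (transportOn Φ f s t u) = f t := (hΦ.bijOn_transportOn f hst).mapsTo hu
  rcases hst.eq_or_lt with rfl | hst
  · rw [hΦ.transportOn_self f hu]
    exact hΦ.transportOn_self (fun x => f (k - x)) (by simpa using hu)
  have hinv := (hΦ.par212 fun x => f (s + (t - s) * x)).1 u (by simpa [lpt] using hu)
  rw [← hΦ.transportOn_unitInterval (fun x => f (k - x)) (by linarith) (by simpa using hv),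
    ← hΦ.transportOn_unitInterval f hst hu]
  refine Eq.trans ?_ hinv
  refine congrArg (fun γ => Φ 0 1 γ _) (funext fun x => congrArg f ?_)
  simp only
  ring

theorem exists_transportOn_eq (hΦ : IsParTransport π Φ) (f : ℝ → B) {a s : ℝ} (has : a ≤ s)
    {u : E} (hu : π u = f s) : ∃ w, π w = f a ∧ transportOn Φ f a s w = u :=
  (hΦ.bijOn_transportOn f has).surjOn hu

variable [Nonempty E]

theorem indTransport_apply (hΦ : IsParTransport π Φ) {f : ℝ → B} {a b : ℝ} {γ : Icc a b → B}
    (hf : ∀ x : Icc a b, γ x = f x) (s t : Icc a b) {w : E} (hw : π w = f a) :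
    indTransport π Φ a b γ s t (transportOn Φ f a s w) = transportOn Φ f a t w := by
  obtain rfl : γ = fun x : Icc a b => f x := funext hf
  exact congrArg (transportOn Φ f a t)
    ((hΦ.bijOn_transportOn f s.2.1).invOn_invFunOn.1 hw)

theorem exists_extension {a b : ℝ} (s : Icc a b) (γ : Icc a b → B) :
    ∃ f : ℝ → B, ∀ x : Icc a b, γ x = f x :=
  ⟨IccExtend (s.2.1.trans s.2.2) γ, fun x => (IccExtend_val _ γ x).symm⟩

theorem indTransport_mapsTo (hΦ : IsParTransport π Φ) {a b : ℝ} (γ : Icc a b → B)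
    (s t : Icc a b) {u : E} (hu : π u = γ s) : π (indTransport π Φ a b γ s t u) = γ t := by
  obtain ⟨f, hf⟩ := exists_extension s γ
  rw [hf] at hu ⊢
  obtain ⟨w, hw, rfl⟩ := hΦ.exists_transportOn_eq f s.2.1 hu
  rw [hΦ.indTransport_apply hf s t hw]
  exact (hΦ.bijOn_transportOn f t.2.1).mapsTo hw

theorem indTransport_comp (hΦ : IsParTransport π Φ) {a b : ℝ} (γ : Icc a b → B)
    (r s t : Icc a b) {u : E} (hu : π u = γ s) :
    indTransport π Φ a b γ t r (indTransport π Φ a b γ s t u) =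
      indTransport π Φ a b γ s r u := by
  obtain ⟨f, hf⟩ := exists_extension s γ
  rw [hf] at hu
  obtain ⟨w, hw, rfl⟩ := hΦ.exists_transportOn_eq f s.2.1 hu
  simp only [hΦ.indTransport_apply hf _ _ hw]

theorem indTransport_self (hΦ : IsParTransport π Φ) {a b : ℝ} (γ : Icc a b → B)
    (s : Icc a b) {u : E} (hu : π u = γ s) : indTransport π Φ a b γ s s u = u := by
  obtain ⟨f, hf⟩ := exists_extension s γ
  rw [hf] at hu
  obtain ⟨w, hw, rfl⟩ := hΦ.exists_transportOn_eq f s.2.1 hu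
  exact hΦ.indTransport_apply hf s s hw

theorem indTransport_bijOn (hΦ : IsParTransport π Φ) {a b : ℝ} (γ : Icc a b → B)
    (s t : Icc a b) :
    BijOn (indTransport π Φ a b γ s t) (Fibre π (γ s)) (Fibre π (γ t)) :=
  InvOn.bijOn (f' := indTransport π Φ a b γ t s)
    ⟨fun _ hu => (hΦ.indTransport_comp γ s s t hu).trans (hΦ.indTransport_self γ s hu),
      fun _ hu => (hΦ.indTransport_comp γ t t s hu).trans (hΦ.indTransport_self γ t hu)⟩
    (fun _ hu => hΦ.indTransport_mapsTo γ s t hu) (fun _ hu => hΦ.indTransport_mapsTo γ t s hu)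

theorem indTransport_restr (hΦ : IsParTransport π Φ) : Cond15 π (indTransport π Φ) := by
  intro a b c d γ h s t u hu
  obtain ⟨f, hf⟩ := exists_extension (inclusion h s) γ
  have hac : a ≤ c := (h (left_mem_Icc.mpr (s.2.1.trans s.2.2))).1
  rw [hf] at hu
  obtain ⟨v, hv, rfl⟩ := hΦ.exists_transportOn_eq f s.2.1 hu
  obtain ⟨w, hw, rfl⟩ := hΦ.exists_transportOn_eq f hac hv
  rw [hΦ.indTransport_apply (γ := restr γ h) (fun x => hf (inclusion h x)) s t hv,
    hΦ.transportOn_comp f hac s.2.1 hw, hΦ.transportOn_comp f hac t.2.1 hw]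
  exact (hΦ.indTransport_apply hf (inclusion h s) (inclusion h t) hw).symm

theorem indTransport_comp_strictMono (hΦ : IsParTransport π Φ) {a b c d : ℝ} (γ : Icc a b → B)
    {τ : Icc c d → Icc a b} (hτ : Surjective τ) (hmono : StrictMono τ) (s t : Icc c d) {u : E}
    (hu : π u = γ (τ s)) :
    indTransport π Φ c d (γ ∘ τ) s t u = indTransport π Φ a b γ (τ s) (τ t) u := by
  have hcd : c ≤ d := s.2.1.trans s.2.2
  have hab : a ≤ b := (τ s).2.1.trans (τ s).2.2
  obtain ⟨f, hf⟩ := exists_extension (τ s) γ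
  let σ : ℝ → ℝ := IccExtend hcd fun x => (τ x : ℝ)
  have hσ (x : Icc c d) : σ x = τ x := IccExtend_val hcd _ x
  have hσc : σ c = a := by
    obtain ⟨x, hx⟩ := hτ (lpt hab)
    have hle : τ (lpt hcd) ≤ τ x := hmono.monotone x.2.1
    rw [hx] at hle
    exact (hσ (lpt hcd)).trans (le_antisymm hle (τ (lpt hcd)).2.1)
  have hreparam (x : Icc c d) {w : E} (hw : π w = f a) :
      transportOn Φ (f ∘ σ) c x w = transportOn Φ f a (τ x) w := by
    refine hΦ.transportOn_reparam σ x.2.1 hσc (hσ x) (fun y hy z hz hyz => ?_) (fun y hy => ?_)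
      (fun _ _ => rfl) hw
    · have hy' : y ∈ Icc c d := ⟨hy.1, hy.2.trans x.2.2⟩
      have hz' : z ∈ Icc c d := ⟨hz.1, hz.2.trans x.2.2⟩
      rw [hσ ⟨y, hy'⟩, hσ ⟨z, hz'⟩]
      exact hmono (show (⟨y, hy'⟩ : Icc c d) < ⟨z, hz'⟩ from hyz)
    · obtain ⟨z, hz⟩ := hτ ⟨y, hy.1, hy.2.trans (τ x).2.2⟩
      have hzx : z ≤ x := hmono.le_iff_le.mp (by rw [hz]; exact hy.2)
      exact ⟨z, ⟨z.2.1, hzx⟩, by rw [hσ, hz]⟩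
  rw [hf] at hu
  obtain ⟨w, hw, rfl⟩ := hΦ.exists_transportOn_eq f (τ s).2.1 hu
  rw [hΦ.indTransport_apply hf _ _ hw, ← hreparam s hw, ← hreparam t hw]
  refine hΦ.indTransport_apply (γ := γ ∘ τ) (f := f ∘ σ) (fun x => ?_) s t ?_
  · simp only [comp_apply, hf, hσ]
  · simpa only [comp_apply, hσc] using hw

/-- The order-reversing affine involution `x ↦ a + b - x` of `[a,b]`. -/
def reflectIcc {a b : ℝ} (x : Icc a b) : Icc a b :=
  ⟨a + b - x, by linarith [x.2.2], by linarith [x.2.1]⟩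

theorem reflectIcc_reflectIcc {a b : ℝ} (x : Icc a b) : reflectIcc (reflectIcc x) = x :=
  Subtype.ext (sub_sub_cancel _ _)

theorem indTransport_comp_reflectIcc (hΦ : IsParTransport π Φ) {a b : ℝ} (γ : Icc a b → B)
    (s t : Icc a b) {u : E} (hu : π u = γ (reflectIcc s)) :
    indTransport π Φ a b (γ ∘ reflectIcc) s t u =
      indTransport π Φ a b γ (reflectIcc s) (reflectIcc t) u := by
  obtain ⟨f, hf⟩ := exists_extension s γ
  rw [hf] at hu
  obtain ⟨z, hz, rfl⟩ := hΦ.exists_transportOn_eq f (reflectIcc s).2.1 hu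
  have hreverse (x : Icc a b) : transportOn Φ (fun y => f (a + b - y)) a x
      (transportOn Φ f a b z) = transportOn Φ f a (reflectIcc x) z := by
    rw [← hΦ.transportOn_comp f (reflectIcc x).2.1 (reflectIcc x).2.2 hz]
    exact hΦ.transportOn_reverse (a + b) (reflectIcc x).2.2 (by ring)
      (sub_sub_cancel _ _).symm (fun _ _ => rfl)
      ((hΦ.bijOn_transportOn f (reflectIcc x).2.1).mapsTo hz)
  rw [hΦ.indTransport_apply hf _ _ hz, ← hreverse s, ← hreverse t]
  refine hΦ.indTransport_apply (fun x => hf (reflectIcc x)) s t ?_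
  rw [add_sub_cancel_left]
  exact (hΦ.bijOn_transportOn f (s.2.1.trans s.2.2)).mapsTo hz

theorem indTransport_comp_strictAnti (hΦ : IsParTransport π Φ) {a b c d : ℝ} (γ : Icc a b → B)
    {τ : Icc c d → Icc a b} (hτ : Surjective τ) (hanti : StrictAnti τ) (s t : Icc c d) {u : E}
    (hu : π u = γ (τ s)) :
    indTransport π Φ c d (γ ∘ τ) s t u = indTransport π Φ a b γ (τ s) (τ t) u := by
  have hreflect : (γ ∘ reflectIcc) ∘ (reflectIcc ∘ τ) = γ ∘ τ := by
    funext x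
    simp only [comp_apply, reflectIcc_reflectIcc]
  have hmono : StrictMono (reflectIcc ∘ τ) := fun x y hxy =>
    sub_lt_sub_left (show (τ y : ℝ) < τ x from hanti hxy) (a + b)
  have hsurj : Surjective (reflectIcc ∘ τ) :=
    (Involutive.surjective reflectIcc_reflectIcc).comp hτ
  have hu' : π u = γ (reflectIcc (reflectIcc (τ s))) := by rwa [reflectIcc_reflectIcc]
  rw [← hreflect, hΦ.indTransport_comp_strictMono (γ ∘ reflectIcc) hsurj hmono s t hu']
  simp only [comp_apply]
  rw [hΦ.indTransport_comp_reflectIcc γ _ _ hu', reflectIcc_reflectIcc, reflectIcc_reflectIcc]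

end IsParTransport

/-- Theorem 3.1, second direction: if `φ` is an axiomatically defined
parallel transport, then `I^γ_{s→t} := φ_{γ|[a,t]} ∘ (φ_{γ|[a,s]})⁻¹` is a transport
along paths (bijections between the fibres satisfying (1.2) and (1.3)) which satisfies
(1.5), and (1.6) for every strictly monotone bijection `τ`. -/
theorem stmt9 [Nonempty E] (π : E → B) (Φ : ∀ (a b : ℝ), (Icc a b → B) → E → E)
    (hΦ : IsParTransport π Φ) :
    (∀ (a b : ℝ) (γ : Icc a b → B) (s t : Icc a b),
        Set.BijOn (indTransport π Φ a b γ s t) (Fibre π (γ s)) (Fibre π (γ t))) ∧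
    (∀ (a b : ℝ) (γ : Icc a b → B) (r s t : Icc a b) (u : E), π u = γ s →
        indTransport π Φ a b γ t r (indTransport π Φ a b γ s t u) =
          indTransport π Φ a b γ s r u) ∧
    (∀ (a b : ℝ) (γ : Icc a b → B) (s : Icc a b) (u : E), π u = γ s →
        indTransport π Φ a b γ s s u = u) ∧
    Cond15 π (indTransport π Φ) ∧
    (∀ (a b c d : ℝ) (γ : Icc a b → B) (τ : Icc c d → Icc a b),
        Function.Bijective τ → (StrictMono τ ∨ StrictAnti τ) →
        ∀ (s t : Icc c d) (u : E), π u = γ (τ s) →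
          indTransport π Φ c d (γ ∘ τ) s t u = indTransport π Φ a b γ (τ s) (τ t) u) := by
  refine ⟨fun a b γ => hΦ.indTransport_bijOn γ,
    fun a b γ r s t u hu => hΦ.indTransport_comp γ r s t hu,
    fun a b γ s u hu => hΦ.indTransport_self γ s hu, hΦ.indTransport_restr, ?_⟩
  rintro a b c d γ τ hτ (hmono | hanti) s t u hu
  · exact hΦ.indTransport_comp_strictMono γ hτ.surjective hmono s t hu
  · exact hΦ.indTransport_comp_strictAnti γ hτ.surjective hanti s t hu
end

section
/- (Proposition 5.1, equivalence of (5.2) and (5.3).) Let n ∈ ℕ and let F, F₁ : ℝ → Matrix(n,n,ℝ) be differentiable matrix-valued functions such that F(s) and F₁(s) are invertible for every s ∈ ℝ. Define H(t,s) := F(t)⁻¹·F(s) and H₁(t,s) := F₁(t)⁻¹·F₁(s), and the coefficient matrices Γ(s) := (∂H(s,t)/∂t)|_{t=s} and Γ₁(s) := (∂H₁(s,t)/∂t)|_{t=s}. Let τ : ℝ → ℝ be differentiable. Then the following are equivalent: (5.2) H₁(t,s) = H(τ(t), τ(s)) for all s,t ∈ ℝ; (5.3) Γ₁(s) = τ'(s)·Γ(τ(s))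 for all s ∈ ℝ. -/
section MatrixDerivative

attribute [local instance] Matrix.linftyOpNormedRing Matrix.linftyOpNormedAlgebra

variable {n : ℕ} {A : ℝ → Matrix (Fin n) (Fin n) ℝ} {A' : Matrix (Fin n) (Fin n) ℝ} {x : ℝ}

theorem Matrix.hasDerivAt_iff_entries :
    HasDerivAt A A' x ↔ ∀ i j, HasDerivAt (fun s => A s i j) (A' i j) x := by
  have h : HasDerivAt A A' x ↔ ∀ i, HasDerivAt (fun s => A s i) (A' i) x := hasDerivAt_pi
  rw [h]
  exact forall_congr' fun i => hasDerivAt_pi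

theorem Matrix.hasDerivAt_inv (hA : HasDerivAt A A' x) (hx : IsUnit (A x)) :
    HasDerivAt (fun s => (A s)⁻¹) (-((A x)⁻¹ * A' * (A x)⁻¹)) x := by
  obtain ⟨u, hu⟩ := hx
  have h := hasFDerivAt_ringInverse (𝕜 := ℝ) u
  rw [hu] at h
  have h' := h.comp_hasDerivAt x hA
  have hinv : (↑u⁻¹ : Matrix (Fin n) (Fin n) ℝ) = (A x)⁻¹ := by
    rw [Matrix.coe_units_inv, hu]
  simp only [Function.comp_def, hinv, ← Matrix.nonsing_inv_eq_ringInverse,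
    _root_.neg_apply, ContinuousLinearMap.mulLeftRight_apply] at h'
  exact h'

theorem Matrix.hasDerivAt_const_mul_apply (C : Matrix (Fin n) (Fin n) ℝ)
    (hA : ∀ i j, HasDerivAt (fun s => A s i j) (A' i j) x) (i j : Fin n) :
    HasDerivAt (fun s => (C * A s) i j) ((C * A') i j) x :=
  Matrix.hasDerivAt_iff_entries.1 ((Matrix.hasDerivAt_iff_entries.2 hA).const_mul C) i j

theorem Matrix.mul_inv_eq_of_logDeriv_eq {A B A' B' : ℝ → Matrix (Fin n) (Fin n) ℝ}
    (hA : ∀ s i j, HasDerivAt (fun s => A s i j) (A' s i j) s)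
    (hB : ∀ s i j, HasDerivAt (fun s => B s i j) (B' s i j) s)
    (hAu : ∀ s, IsUnit (A s)) (hBu : ∀ s, IsUnit (B s))
    (h : ∀ s, (A s)⁻¹ * A' s = (B s)⁻¹ * B' s) (t s : ℝ) :
    A t * (B t)⁻¹ = A s * (B s)⁻¹ := by
  have hd (r : ℝ) : HasDerivAt (fun s => A s * (B s)⁻¹) 0 r := by
    have h1 := (Matrix.hasDerivAt_iff_entries.2 (hA r)).mul
      (Matrix.hasDerivAt_inv (Matrix.hasDerivAt_iff_entries.2 (hB r)) (hBu r))
    have h2 : A' r = A r * ((B r)⁻¹ * B' r) := by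
      rw [← h r, Matrix.mul_nonsing_inv_cancel_left _ _ ((Matrix.isUnit_iff_isUnit_det _).1 (hAu r))]
    have h3 : A' r * (B r)⁻¹ + A r * -((B r)⁻¹ * B' r * (B r)⁻¹) = 0 := by
      rw [h2]; noncomm_ring
    rw [← h3]
    exact h1
  exact is_const_of_deriv_eq_zero (fun r => (hd r).differentiableAt) (fun r => (hd r).deriv) t s

end MatrixDerivative


/-- Proposition 5.1, equivalence of (5.2) and (5.3): for differentiable
families `F, F₁` of invertible `n × n` real matrices, with `H(t,s) := F(t)⁻¹ · F(s)`,
`H₁(t,s) := F₁(t)⁻¹ · F₁(s)`, coefficient matrices `Γ(s) := ∂H(s,t)/∂t |_{t=s}`,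
`Γ₁(s) := ∂H₁(s,t)/∂t |_{t=s}`, and a differentiable change of parameter `τ : ℝ → ℝ`,
the conditions `H₁(t,s) = H(τ(t), τ(s))` for all `s, t` and
`Γ₁(s) = τ'(s) • Γ(τ(s))` for all `s` are equivalent. -/
theorem stmt19 (n : ℕ) (F F₁ : ℝ → Matrix (Fin n) (Fin n) ℝ) (τ : ℝ → ℝ)
    (hF : ∀ i j, Differentiable ℝ (fun s => F s i j))
    (hF₁ : ∀ i j, Differentiable ℝ (fun s => F₁ s i j))
    (hFinv : ∀ s, IsUnit (F s)) (hF₁inv : ∀ s, IsUnit (F₁ s))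
    (hτ : Differentiable ℝ τ)
    (H H₁ : ℝ → ℝ → Matrix (Fin n) (Fin n) ℝ)
    (hH : ∀ t s, H t s = (F t)⁻¹ * F s)
    (hH₁ : ∀ t s, H₁ t s = (F₁ t)⁻¹ * F₁ s)
    (Gm Gm₁ : ℝ → Matrix (Fin n) (Fin n) ℝ)
    (hGm : ∀ s i j, Gm s i j = deriv (fun t => H s t i j) s)
    (hGm₁ : ∀ s i j, Gm₁ s i j = deriv (fun t => H₁ s t i j) s) :
    (∀ t s, H₁ t s = H (τ t) (τ s)) ↔ (∀ s, Gm₁ s = deriv τ s • Gm (τ s)) := by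
  have hD (s) (i j) : HasDerivAt (fun s => F s i j)
      (Matrix.of (fun i j => deriv (fun s => F s i j) s) i j) s := (hF i j s).hasDerivAt
  have hD₁ (s) (i j) : HasDerivAt (fun s => F₁ s i j)
      (Matrix.of (fun i j => deriv (fun s => F₁ s i j) s) i j) s := (hF₁ i j s).hasDerivAt
  have hdH (s) (i j) := Matrix.hasDerivAt_const_mul_apply (F s)⁻¹ (hD s) i j
  have hdH₁ (s) (i j) := Matrix.hasDerivAt_const_mul_apply (F₁ s)⁻¹ (hD₁ s) i j
  constructor
  · intro h s
    ext i j
    rw [hGm₁, Matrix.smul_apply, hGm, smul_eq_mul, mul_comm]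
    simp only [h, hH]
    exact ((hdH (τ s) i j).differentiableAt.hasDerivAt.comp s (hτ s).hasDerivAt).deriv
  · intro h t s
    have hG (s) : Gm s = (F s)⁻¹ * Matrix.of fun i j => deriv (fun s => F s i j) s := by
      ext i j
      rw [hGm]
      simp only [hH]
      exact (hdH s i j).deriv
    have hG₁ (s) : Gm₁ s = (F₁ s)⁻¹ * Matrix.of fun i j => deriv (fun s => F₁ s i j) s := by
      ext i j
      rw [hGm₁]
      simp only [hH₁]
      exact (hdH₁ s i j).deriv
    have hDτ (s) (i j) : HasDerivAt (fun s => F (τ s) i j)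
        ((deriv τ s • Matrix.of (fun i j => deriv (fun s => F s i j) (τ s))) i j) s := by
      rw [Matrix.smul_apply, smul_eq_mul, mul_comm]
      exact (hD (τ s) i j).comp s (hτ s).hasDerivAt
    have key := Matrix.mul_inv_eq_of_logDeriv_eq hD₁ hDτ hF₁inv (fun s => hFinv (τ s))
      (fun s => by
        have := h s
        rw [hG, hG₁] at this
        rw [this, Matrix.mul_smul]) s t
    have hu := (Matrix.isUnit_iff_isUnit_det _).1 (hF₁inv t)
    have hv := (Matrix.isUnit_iff_isUnit_det _).1 (hFinv (τ s))
    rw [hH, hH₁, ← Matrix.nonsing_inv_mul_cancel_right (F (τ s)) (F₁ s) hv, key,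
      Matrix.mul_assoc (F₁ t), Matrix.nonsing_inv_mul_cancel_left _ _ hu]
end
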